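/- (Hayashi realization of the Fock space: Serre relations.) The operators E_i, F_i on the Fock space F satisfy the q-Serre relations of U_q(ŝl_ℓ): if ℓ ≥ 3 and i, j ∈ Z/ℓ with j ≢ i and j ≢ i ± 1 (mod ℓ), then E_i E_j = E_j E_i and F_i F_j = F_j F_i; if ℓ ≥ 3 and j ≡ i ± 1 (mod ℓ), then E_i² E_j − (q + q^{−1}) E_i E_j E_i + E_j E_i² = 0 and F_i² F_j − (q + q^{−1}) F_i F_j F_i + F_j F_i² = 0; and if ℓ = 2 and i ≠ j, then E_i³ E_j − [3] E_i² E_j E_i + [3] E_i E_j E_i² − E_j E_i³ = 0 and F_i³ F_j − [3] F_i² F_j F_i + [3] F_i F_j F_i² − F_j F_i³ = 0, where [3] = q² + 1 + q^{−2}. -/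

import Mathlib

noncomputable section

open scoped BigOperators Classical

namespace FockSpace

/-- The base field `ℚ(q)`. -/
abbrev Fq : Type := RatFunc ℚ

/-- The indeterminate `q ∈ ℚ(q)`. -/
def qq : Fq := RatFunc.X

/-- The Fock space: the free `ℚ(q)`-module on the set of all partitions (identified with
their Young diagrams). -/
abbrev Fock : Type := YoungDiagram →₀ Fq

variable (ℓ : ℕ)

/-- The `ℓ`-residue of a cell `(r, c)` (0-indexed rows and columns): `(c - r) mod ℓ`. -/
def res (x : ℕ × ℕ) : ZMod ℓ := (((x.2 : ℤ) - (x.1 : ℤ) : ℤ) : ZMod ℓ)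

/-- `x` is an addable cell of `μ`: `x ∉ μ` and `μ ∪ {x}` is again a Young diagram. -/
def IsAddableCell (μ : YoungDiagram) (x : ℕ × ℕ) : Prop :=
  x ∉ μ ∧ IsLowerSet (insert x (μ.cells : Set (ℕ × ℕ)))

/-- `x` is a removable cell of `μ`: `x ∈ μ` and `μ \ {x}` is again a Young diagram. -/
def IsRemovableCell (μ : YoungDiagram) (x : ℕ × ℕ) : Prop :=
  x ∈ μ ∧ IsLowerSet ((μ.cells.erase x : Finset (ℕ × ℕ)) : Set (ℕ × ℕ))

/-- The finite set of `i`-addable cells of `μ`. -/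
def addables (i : ZMod ℓ) (μ : YoungDiagram) : Finset (ℕ × ℕ) :=
  (Finset.range (μ.cells.card + 1) ×ˢ Finset.range (μ.cells.card + 1)).filter
    fun x => IsAddableCell μ x ∧ res ℓ x = i

/-- The finite set of `i`-removable cells of `μ`. -/
def removables (i : ZMod ℓ) (μ : YoungDiagram) : Finset (ℕ × ℕ) :=
  μ.cells.filter fun x => IsRemovableCell μ x ∧ res ℓ x = i

/-- Adding a cell to a Young diagram (returns `μ` unchanged if the result would not be a
Young diagram). -/
def addCell (μ : YoungDiagram) (x : ℕ × ℕ) : YoungDiagram :=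
  if h : IsLowerSet (insert x (μ.cells : Set (ℕ × ℕ))) then
    ⟨insert x μ.cells, by simpa using h⟩
  else μ

/-- Removing a cell from a Young diagram (returns `μ` unchanged if the result would not be
a Young diagram). -/
def eraseCell (μ : YoungDiagram) (x : ℕ × ℕ) : YoungDiagram :=
  if h : IsLowerSet ((μ.cells.erase x : Finset (ℕ × ℕ)) : Set (ℕ × ℕ)) then
    ⟨μ.cells.erase x, h⟩
  else μ

/-- `N_i^a(λ, μ)` where `μ = λ ∪ {x}`: the number of `i`-addable minus `i`-removable cells
of `λ` in rows strictly above `x`. -/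
def Na (i : ZMod ℓ) (lam : YoungDiagram) (x : ℕ × ℕ) : ℤ :=
  (((addables ℓ i lam).filter fun y => y.1 < x.1).card : ℤ)
    - (((removables ℓ i lam).filter fun y => y.1 < x.1).card : ℤ)

/-- `N_i^b(λ, μ)` where `μ = λ ∪ {x}`: the number of `i`-addable minus `i`-removable cells
of `λ` in rows strictly below `x`. -/
def Nb (i : ZMod ℓ) (lam : YoungDiagram) (x : ℕ × ℕ) : ℤ :=
  (((addables ℓ i lam).filter fun y => x.1 < y.1).card : ℤ)
    - (((removables ℓ i lam).filter fun y => x.1 < y.1).card : ℤ)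

/-- `N_i(λ)`: the number of `i`-addable minus `i`-removable cells of `λ`. -/
def Nstat (i : ZMod ℓ) (lam : YoungDiagram) : ℤ :=
  ((addables ℓ i lam).card : ℤ) - ((removables ℓ i lam).card : ℤ)

/-- The operator `E_i` of the Hayashi realization:
`E_i |μ⟩ = Σ q^{-N_i^a(λ,μ)} |λ⟩`, summed over `λ` with `μ = λ ∪ {x}`, `res x = i`. -/
def Eop (i : ZMod ℓ) : Module.End Fq Fock :=
  Finsupp.linearCombination Fq fun μ =>
    ∑ x ∈ removables ℓ i μ,
      (qq ^ (-(Na ℓ i (eraseCell μ x) x))) • Finsupp.single (eraseCell μ x) (1 : Fq)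

/-- The operator `F_i` of the Hayashi realization:
`F_i |λ⟩ = Σ q^{N_i^b(λ,μ)} |μ⟩`, summed over `μ` with `μ = λ ∪ {x}`, `res x = i`. -/
def Fop (i : ZMod ℓ) : Module.End Fq Fock :=
  Finsupp.linearCombination Fq fun lam =>
    ∑ x ∈ addables ℓ i lam,
      (qq ^ (Nb ℓ i lam x)) • Finsupp.single (addCell lam x) (1 : Fq)

/-- The operator `K_i` of the Hayashi realization: `K_i |λ⟩ = q^{N_i(λ)} |λ⟩`. -/
def Kop (i : ZMod ℓ) : Module.End Fq Fock :=
  Finsupp.linearCombination Fq fun lam =>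
    (qq ^ (Nstat ℓ i lam)) • Finsupp.single lam (1 : Fq)

/-- The operator `K_i⁻¹` of the Hayashi realization: `K_i⁻¹ |λ⟩ = q^{-N_i(λ)} |λ⟩`. -/
def Kinvop (i : ZMod ℓ) : Module.End Fq Fock :=
  Finsupp.linearCombination Fq fun lam =>
    (qq ^ (-(Nstat ℓ i lam))) • Finsupp.single lam (1 : Fq)


section Ring
set_option linter.unusedSimpArgs false
variable {K A : Type*} [Field K] [Ring A] [Algebra K A]

theorem serre2 (q : K) (hq : q ≠ 0) (L N R y : A)
    (hNL : N * L = (q⁻¹) ^ 2 • (L * N)) (hRN : R * N = (q⁻¹) ^ 2 • (N * R))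
    (hRL : R * L = (q⁻¹) ^ 2 • (L * R))
    (hyL : y * L = q • (L * y)) (hRy : R * y = q • (y * R))
    (hNN : N * N = 0) (hNyN : N * (y * N) = 0) :
    (L + N + R) ^ 2 * y - (q + q⁻¹) • ((L + N + R) * y * (L + N + R))
      + y * (L + N + R) ^ 2 = 0 := by
  have hNL' : ∀ z, N * (L * z) = (q⁻¹) ^ 2 • (L * (N * z)) := fun z => by
    rw [← mul_assoc, hNL, smul_mul_assoc, mul_assoc]
  have hRN' : ∀ z, R * (N * z) = (q⁻¹) ^ 2 • (N * (R * z)) := fun z => by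
    rw [← mul_assoc, hRN, smul_mul_assoc, mul_assoc]
  have hRL' : ∀ z, R * (L * z) = (q⁻¹) ^ 2 • (L * (R * z)) := fun z => by
    rw [← mul_assoc, hRL, smul_mul_assoc, mul_assoc]
  have hyL' : ∀ z, y * (L * z) = q • (L * (y * z)) := fun z => by
    rw [← mul_assoc, hyL, smul_mul_assoc, mul_assoc]
  have hRy' : ∀ z, R * (y * z) = q • (y * (R * z)) := fun z => by
    rw [← mul_assoc, hRy, smul_mul_assoc, mul_assoc]
  have hNN' : ∀ z, N * (N * z) = 0 := fun z => by
    rw [← mul_assoc, hNN, zero_mul]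
  simp only [pow_two (L + N + R), mul_add, add_mul, mul_assoc, hNL, hRN, hRL, hyL, hRy, hNL', hRN',
    hRL', hyL', hRy', hNN, hNN', hNyN, mul_smul_comm, smul_mul_assoc, smul_zero, mul_zero, zero_mul]
  match_scalars <;> field_simp <;> ring

theorem serre3 (q : K) (hq : q ≠ 0) (L N R y : A)
    (hNL : N * L = (q⁻¹) ^ 2 • (L * N)) (hRN : R * N = (q⁻¹) ^ 2 • (N * R))
    (hRL : R * L = (q⁻¹) ^ 2 • (L * R))
    (hyL : y * L = q ^ 2 • (L * y)) (hRy : R * y = q ^ 2 • (y * R))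
    (hNNN : N * (N * N) = 0) (hNyNN : N * (y * (N * N)) = 0) (hNNyN : N * (N * (y * N)) = 0) :
    (L + N + R) ^ 3 * y - (q ^ 2 + 1 + q ^ (-2 : ℤ)) • ((L + N + R) ^ 2 * y * (L + N + R))
      + (q ^ 2 + 1 + q ^ (-2 : ℤ)) • ((L + N + R) * y * (L + N + R) ^ 2)
      - y * (L + N + R) ^ 3 = 0 := by
  have hNL' : ∀ z, N * (L * z) = (q⁻¹) ^ 2 • (L * (N * z)) := fun z => by
    rw [← mul_assoc, hNL, smul_mul_assoc, mul_assoc]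
  have hRN' : ∀ z, R * (N * z) = (q⁻¹) ^ 2 • (N * (R * z)) := fun z => by
    rw [← mul_assoc, hRN, smul_mul_assoc, mul_assoc]
  have hRL' : ∀ z, R * (L * z) = (q⁻¹) ^ 2 • (L * (R * z)) := fun z => by
    rw [← mul_assoc, hRL, smul_mul_assoc, mul_assoc]
  have hyL' : ∀ z, y * (L * z) = q ^ 2 • (L * (y * z)) := fun z => by
    rw [← mul_assoc, hyL, smul_mul_assoc, mul_assoc]
  have hRy' : ∀ z, R * (y * z) = q ^ 2 • (y * (R * z)) := fun z => by
    rw [← mul_assoc, hRy, smul_mul_assoc, mul_assoc]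
  have hNNN' : ∀ z, N * (N * (N * z)) = 0 := fun z => by
    rw [← mul_assoc N N z, ← mul_assoc, hNNN, zero_mul]
  have e : q ^ (-2 : ℤ) = (q⁻¹) ^ 2 := by
    rw [zpow_neg, inv_pow]; norm_cast
  rw [e]
  simp only [pow_two (L + N + R), pow_succ (L + N + R) 2, mul_add, add_mul, mul_assoc, hNL, hRN,
    hRL, hyL, hRy, hNL', hRN',
    hRL', hyL', hRy', hNNN, hNNN', hNyNN, hNNyN, mul_smul_comm, smul_mul_assoc, smul_zero, mul_zero, zero_mul]
  match_scalars <;> field_simp <;> ring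

theorem sum_qcomm {ι κ : Type*} (x : ι → A) (y : κ → A) (S : Finset ι) (T : Finset κ) (r : K)
    (h : ∀ a ∈ S, ∀ b ∈ T, y b * x a = r • (x a * y b)) :
    (∑ b ∈ T, y b) * (∑ a ∈ S, x a) = r • ((∑ a ∈ S, x a) * ∑ b ∈ T, y b) := by
  rw [Finset.sum_mul_sum, Finset.sum_mul_sum, Finset.smul_sum, Finset.sum_comm]
  refine Finset.sum_congr rfl fun a ha => ?_
  rw [Finset.smul_sum]
  exact Finset.sum_congr rfl fun b hb => h a ha b hb

theorem serre2_sum {ι : Type*} (X : A) (y : ι → A) (T : Finset ι) (r : K)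
    (h : ∀ d ∈ T, X ^ 2 * y d - r • (X * y d * X) + y d * X ^ 2 = 0) :
    X ^ 2 * (∑ d ∈ T, y d) - r • (X * (∑ d ∈ T, y d) * X) + (∑ d ∈ T, y d) * X ^ 2 = 0 := by
  rw [Finset.mul_sum, Finset.mul_sum, Finset.sum_mul, Finset.sum_mul, Finset.smul_sum,
    ← Finset.sum_sub_distrib, ← Finset.sum_add_distrib]
  exact Finset.sum_eq_zero h

theorem serre3_sum {ι : Type*} (X : A) (y : ι → A) (T : Finset ι) (r : K)
    (h : ∀ d ∈ T, X ^ 3 * y d - r • (X ^ 2 * y d * X) + r • (X * y d * X ^ 2) - y d * X ^ 3 = 0) :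
    X ^ 3 * (∑ d ∈ T, y d) - r • (X ^ 2 * (∑ d ∈ T, y d) * X)
      + r • (X * (∑ d ∈ T, y d) * X ^ 2) - (∑ d ∈ T, y d) * X ^ 3 = 0 := by
  rw [Finset.mul_sum, Finset.mul_sum, Finset.mul_sum, Finset.sum_mul, Finset.sum_mul,
    Finset.sum_mul, Finset.smul_sum, Finset.smul_sum,
    ← Finset.sum_sub_distrib, ← Finset.sum_add_distrib, ← Finset.sum_sub_distrib]
  exact Finset.sum_eq_zero h

theorem comm_sum {ι : Type*} (X : A) (y : ι → A) (T : Finset ι)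
    (h : ∀ d ∈ T, X * y d = y d * X) :
    X * (∑ d ∈ T, y d) - (∑ d ∈ T, y d) * X = 0 := by
  rw [Finset.mul_sum, Finset.sum_mul, sub_eq_zero]
  exact Finset.sum_congr rfl h

end Ring

section Abs

/-- Condition for a cell of content `c` to be addable, in terms of the profile `g`. -/
def Ok (g : ℤ → ℤ) (c : ℤ) : Prop := g (c - 1) = g c + 1 ∧ g (c + 1) = g c

/-- second difference -/
def sd (g : ℤ → ℤ) (e : ℤ) : ℤ := g (e - 1) - 2 * g e + g (e + 1)

def ind (c e : ℤ) : ℤ := if e < c ∧ (e : ZMod ℓ) = (c : ZMod ℓ) then 1 else 0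

def kap (g : ℤ → ℤ) (c : ℤ) : ℤ := ∑ᶠ e, ind ℓ c e * sd g e

def up (g : ℤ → ℤ) (d : ℤ) : ℤ → ℤ := fun e => if e = d then g e + 1 else g e

def eps (c d : ℤ) : ℤ := -2 * ind ℓ c d + ind ℓ c (d + 1) + ind ℓ c (d - 1)

theorem sd_up (g : ℤ → ℤ) (d e : ℤ) : sd (up g d) e =
    sd g e + ((if e = d then -2 else 0) + (if e = d + 1 then 1 else 0)
      + (if e = d - 1 then 1 else 0)) := by
  unfold sd up
  split_ifs <;> omega

theorem kap_up (g : ℤ → ℤ) (hg : {e | sd g e ≠ 0}.Finite) (c d : ℤ) :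
    kap ℓ (up g d) c = kap ℓ g c + eps ℓ c d := by
  unfold kap
  simp only [sd_up, mul_add]
  have s1 : ∀ (a v : ℤ), (Function.support fun e => ind ℓ c e * (if e = a then v else 0)).Finite := by
    intro a v
    refine (Set.finite_singleton a).subset fun e he => ?_
    by_contra h
    simp at h
    simp [h] at he
  have s2 : ∀ (a v : ℤ), ∑ᶠ e, ind ℓ c e * (if e = a then v else 0) = ind ℓ c a * v := by
    intro a v
    rw [finsum_eq_single _ a]
    · simp
    · intro e he; simp [he]
  have s0 : (Function.support fun e => ind ℓ c e * sd g e).Finite := by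
    refine hg.subset fun e he => ?_
    simp at he
    exact he.2
  have s12 := (s1 d (-2)).union (s1 (d+1) 1)
  have s12' := s12.subset (Function.support_add _ _)
  have s123' := (s12'.union (s1 (d-1) 1)).subset (Function.support_add _ _)
  rw [finsum_add_distrib s0 s123', finsum_add_distrib s12' (s1 _ _),
    finsum_add_distrib (s1 _ _) (s1 _ _), s2, s2, s2]
  unfold eps
  ring

/-- Abstract combinatorial data behind the Fock space. -/
structure FData (Lam : Type) where
  h : Lam → ℤ → ℤ
  inj : Function.Injective h
  f : ℤ → Lam → Lam
  hf : ∀ c l, Ok (h l) c → h (f c l) = up (h l) c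
  fin : ∀ l, {e | sd (h l) e ≠ 0}.Finite

variable {Lam : Type} (D : FData Lam)

def FData.x {K : Type} [Field K] (q : K) (c : ℤ) : Module.End K (Lam →₀ K) :=
  Finsupp.linearCombination K fun l =>
    if Ok (D.h l) c then (q ^ kap ℓ (D.h l) c) • Finsupp.single (D.f c l) (1 : K) else 0

theorem FData.x_single {K : Type} [Field K] (q : K) (c : ℤ) (l : Lam) : D.x ℓ q c (Finsupp.single l 1) =
    if Ok (D.h l) c then (q ^ kap ℓ (D.h l) c) • Finsupp.single (D.f c l) (1 : K) else 0 := by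
  simp [FData.x]

theorem end_ext {K : Type} [Field K] {A B : Module.End K (Lam →₀ K)}
    (h : ∀ l, A (Finsupp.single l 1) = B (Finsupp.single l 1)) : A = B :=
  Finsupp.lhom_ext' fun l => LinearMap.ext_ring (h l)

theorem Ok_up {g : ℤ → ℤ} {c d : ℤ} (h : c + 1 < d ∨ d + 1 < c) : Ok (up g c) d ↔ Ok g d := by
  unfold Ok up
  rw [if_neg (by omega), if_neg (by omega), if_neg (by omega)]

theorem FData.x_pos {K : Type} [Field K] (q : K) (hq : q ≠ 0) {c : ℤ} {l : Lam} (h : Ok (D.h l) c) : D.x ℓ q c (Finsupp.single l 1) =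
    (q ^ kap ℓ (D.h l) c) • Finsupp.single (D.f c l) (1 : K) := by
  rw [D.x_single, if_pos h]

theorem FData.x_neg {K : Type} [Field K] (q : K) (hq : q ≠ 0) {c : ℤ} {l : Lam} (h : ¬ Ok (D.h l) c) :
    D.x ℓ q c (Finsupp.single l 1) = 0 := by
  rw [D.x_single, if_neg h]

theorem FData.x_comm0 {K : Type} [Field K] (q : K) (hq : q ≠ 0) {c d : ℤ} (h : c + 1 < d ∨ d + 1 < c) :
    D.x ℓ q d * D.x ℓ q c = q ^ (eps ℓ d c - eps ℓ c d) • (D.x ℓ q c * D.x ℓ q d) := by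
  apply end_ext
  intro l
  simp only [Module.End.mul_apply, LinearMap.smul_apply]
  by_cases hc : Ok (D.h l) c
  · have hc' := D.hf _ _ hc
    by_cases hd : Ok (D.h l) d
    · have hd' := D.hf _ _ hd
      have o1 : Ok (D.h (D.f c l)) d := by rw [hc']; exact (Ok_up h).2 hd
      have o2 : Ok (D.h (D.f d l)) c := by rw [hd']; exact (Ok_up h.symm).2 hc
      have e : D.f d (D.f c l) = D.f c (D.f d l) := by
        apply D.inj
        rw [D.hf _ _ o1, D.hf _ _ o2, hc', hd']
        funext e; unfold up; split_ifs <;> omega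
      rw [D.x_pos ℓ q hq hc, D.x_pos ℓ q hq hd, map_smul, map_smul, D.x_pos ℓ q hq o1, D.x_pos ℓ q hq o2, e, hc', hd',
        smul_smul, smul_smul, smul_smul, kap_up ℓ _ (D.fin l), kap_up ℓ _ (D.fin l),
        ← zpow_add₀ hq, ← zpow_add₀ hq, ← zpow_add₀ hq]
      congr 2
      ring
    · have o1 : ¬ Ok (D.h (D.f c l)) d := by rw [hc']; exact fun o => hd ((Ok_up h).1 o)
      rw [D.x_pos ℓ q hq hc, D.x_neg ℓ q hq hd, map_smul, D.x_neg ℓ q hq o1, map_zero, smul_zero, smul_zero]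
  · by_cases hd : Ok (D.h l) d
    · have hd' := D.hf _ _ hd
      have o2 : ¬ Ok (D.h (D.f d l)) c := by rw [hd']; exact fun o => hc ((Ok_up h.symm).1 o)
      rw [D.x_pos ℓ q hq hd, D.x_neg ℓ q hq hc, map_smul, D.x_neg ℓ q hq o2, map_zero, smul_zero, smul_zero]
    · rw [D.x_neg ℓ q hq hd, D.x_neg ℓ q hq hc, map_zero, map_zero, smul_zero]

theorem FData.x_sq {K : Type} [Field K] (q : K) (hq : q ≠ 0) (c : ℤ) : D.x ℓ q c * D.x ℓ q c = 0 := by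
  apply end_ext
  intro l
  simp only [Module.End.mul_apply]
  by_cases hc : Ok (D.h l) c
  · have o : ¬ Ok (D.h (D.f c l)) c := by
      rw [D.hf _ _ hc]
      unfold Ok up at *
      simp
      omega
    rw [D.x_pos ℓ q hq hc, map_smul, D.x_neg ℓ q hq o, smul_zero]; rfl
  · rw [D.x_neg ℓ q hq hc, map_zero]; rfl

theorem FData.x_xyx {K : Type} [Field K] (q : K) (hq : q ≠ 0) {c d : ℤ} (hcd : d = c + 1 ∨ d = c - 1) :
    D.x ℓ q c * (D.x ℓ q d * D.x ℓ q c) = 0 := by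
  apply end_ext
  intro l
  simp only [Module.End.mul_apply]
  by_cases hc : Ok (D.h l) c
  · rw [D.x_pos ℓ q hq hc, map_smul, map_smul]
    by_cases hd : Ok (D.h (D.f c l)) d
    · have o : ¬ Ok (D.h (D.f d (D.f c l))) c := by
        rw [D.hf _ _ hd]
        rw [D.hf _ _ hc] at hd ⊢
        unfold Ok up at *
        rcases hcd with rfl | rfl <;> simp at * <;> omega
      rw [D.x_pos ℓ q hq hd, map_smul, D.x_neg ℓ q hq o, smul_zero, smul_zero]; rfl
    · rw [D.x_neg ℓ q hq hd, map_zero, smul_zero]; rfl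
  · rw [D.x_neg ℓ q hq hc, map_zero, map_zero]; rfl

/-- the exponent depends only on the residues -/
def alp (i j : ZMod ℓ) : ℤ :=
  -2 * (if i = j then 1 else 0) + (if i + 1 = j then 1 else 0) + (if i - 1 = j then 1 else 0)

theorem FData.x_comm {K : Type} [Field K] (q : K) (hq : q ≠ 0) {c d : ℤ} (h : c + 1 < d) :
    D.x ℓ q d * D.x ℓ q c = q ^ (alp ℓ c d) • (D.x ℓ q c * D.x ℓ q d) := by
  rw [D.x_comm0 ℓ q hq (Or.inl h)]
  congr 2
  have h1 : eps ℓ c d = 0 := by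
    unfold eps ind
    rw [if_neg (by omega), if_neg (by omega), if_neg (by omega)]; rfl
  have h2 : eps ℓ d c = alp ℓ c d := by
    unfold eps ind alp
    have a1 : c < d := by omega
    have a2 : c - 1 < d := by omega
    simp [h, a1, a2]
  rw [h1, h2, sub_zero]

end Abs

section Ser
variable {Lam : Type} (D : FData Lam)

theorem cls_gap {c d : ℤ} (h : (c : ZMod ℓ) = d) (hl : c < d) : c + ℓ ≤ d := by
  have := (ZMod.intCast_eq_intCast_iff_dvd_sub c d ℓ).1 h
  have := Int.le_of_dvd (by omega) this
  omega

theorem alp_same (hℓ : 2 ≤ ℓ) (i : ZMod ℓ) : alp ℓ i i = -2 := by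
  have : Fact (1 < ℓ) := ⟨hℓ⟩
  simp [alp]

theorem two_ne (hℓ : 3 ≤ ℓ) : (2 : ZMod ℓ) ≠ 0 := by
  intro h
  have : ((2 : ℕ) : ZMod ℓ) = 0 := by exact_mod_cast h
  rw [ZMod.natCast_eq_zero_iff] at this
  have := Nat.le_of_dvd (by omega) this
  omega

theorem alp_adj (hℓ : 3 ≤ ℓ) (i j : ZMod ℓ) (h : j = i + 1 ∨ j = i - 1) : alp ℓ i j = 1 := by
  have : Fact (1 < ℓ) := ⟨by omega⟩
  have h2 := two_ne ℓ hℓ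
  have e1 : i + 1 ≠ i - 1 := fun e => h2 (by linear_combination e)
  rcases h with rfl | rfl
  · simp [alp, e1.symm]
  · have : i ≠ i - 1 := fun e => one_ne_zero (α := ZMod ℓ) (by linear_combination e)
    simp [alp, e1, this]

theorem alp_two (i j : ZMod 2) (h : i ≠ j) : alp 2 i j = 2 := by
  have : ∀ i j : ZMod 2, i ≠ j → i + 1 = j ∧ i - 1 = j := by decide
  obtain ⟨a, b⟩ := this i j h
  simp [alp, a, b, h]

theorem alp_far (i j : ZMod ℓ) (h0 : j ≠ i) (h1 : j ≠ i + 1) (h2 : j ≠ i - 1) :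
    alp ℓ i j = 0 := by
  simp [alp, h0.symm, h1.symm, h2.symm]

theorem alp_symm (i j : ZMod ℓ) : alp ℓ i j = alp ℓ j i := by
  unfold alp
  have e1 : (i = j) ↔ (j = i) := eq_comm
  have e2 : (i + 1 = j) ↔ (j - 1 = i) := by constructor <;> (intro h; rw [← h]; ring)
  have e3 : (i - 1 = j) ↔ (j + 1 = i) := by constructor <;> (intro h; rw [← h]; ring)
  simp only [e1, e2, e3]
  ring

def lowS (S : Finset ℤ) (d : ℤ) : Finset ℤ := S.filter fun c => c + 1 < d
def midS (S : Finset ℤ) (d : ℤ) : Finset ℤ := S.filter fun c => ¬ (c + 1 < d) ∧ ¬ (d + 1 < c)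
def topS (S : Finset ℤ) (d : ℤ) : Finset ℤ := S.filter fun c => d + 1 < c

theorem split_sum {A : Type*} [AddCommMonoid A] (S : Finset ℤ) (d : ℤ) (x : ℤ → A) :
    ∑ c ∈ S, x c = ∑ c ∈ lowS S d, x c + ∑ c ∈ midS S d, x c + ∑ c ∈ topS S d, x c := by
  unfold lowS midS topS
  rw [Finset.sum_filter, Finset.sum_filter, Finset.sum_filter, ← Finset.sum_add_distrib,
    ← Finset.sum_add_distrib]
  refine Finset.sum_congr rfl fun c _ => ?_
  by_cases h1 : c + 1 < d
  · have h2 : ¬ (d + 1 < c) := by omega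
    simp [h1, h2]
  · by_cases h2 : d + 1 < c <;> simp [h1, h2]

theorem zneg2 {K : Type} [Field K] (q : K) : q ^ (-2 : ℤ) = (q⁻¹) ^ 2 := by
  rw [zpow_neg, inv_pow]; norm_cast

theorem FData.x_same {K : Type} [Field K] (q : K) (hq : q ≠ 0) (hℓ : 2 ≤ ℓ) {c d : ℤ} (h : (c : ZMod ℓ) = d) (hl : c < d) :
    D.x ℓ q d * D.x ℓ q c = (q⁻¹) ^ 2 • (D.x ℓ q c * D.x ℓ q d) := by
  have := cls_gap ℓ h hl
  rw [D.x_comm ℓ q hq (by omega), h, alp_same ℓ hℓ, zneg2]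


theorem FData.NL {K : Type} [Field K] (q : K) (hq : q ≠ 0)
    {S : Finset ℤ} {i : ZMod ℓ} (hS : ∀ c ∈ S, (c : ZMod ℓ) = i)
    (hℓ : 2 ≤ ℓ) (d : ℤ) :
    (∑ c ∈ midS S d, D.x ℓ q c) * (∑ c ∈ lowS S d, D.x ℓ q c)
      = (q⁻¹) ^ 2 • ((∑ c ∈ lowS S d, D.x ℓ q c) * (∑ c ∈ midS S d, D.x ℓ q c)) := by
  refine sum_qcomm (D.x ℓ q) (D.x ℓ q) _ _ _ fun a ha b hb => ?_
  simp only [lowS, midS, Finset.mem_filter] at ha hb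
  exact D.x_same ℓ q hq hℓ ((hS a ha.1).trans (hS b hb.1).symm) (by omega)

theorem FData.RN {K : Type} [Field K] (q : K) (hq : q ≠ 0)
    {S : Finset ℤ} {i : ZMod ℓ} (hS : ∀ c ∈ S, (c : ZMod ℓ) = i)
    (hℓ : 2 ≤ ℓ) (d : ℤ) :
    (∑ c ∈ topS S d, D.x ℓ q c) * (∑ c ∈ midS S d, D.x ℓ q c)
      = (q⁻¹) ^ 2 • ((∑ c ∈ midS S d, D.x ℓ q c) * (∑ c ∈ topS S d, D.x ℓ q c)) := by
  refine sum_qcomm (D.x ℓ q) (D.x ℓ q) _ _ _ fun a ha b hb => ?_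
  simp only [topS, midS, Finset.mem_filter] at ha hb
  exact D.x_same ℓ q hq hℓ ((hS a ha.1).trans (hS b hb.1).symm) (by omega)

theorem FData.RL {K : Type} [Field K] (q : K) (hq : q ≠ 0)
    {S : Finset ℤ} {i : ZMod ℓ} (hS : ∀ c ∈ S, (c : ZMod ℓ) = i)
    (hℓ : 2 ≤ ℓ) (d : ℤ) :
    (∑ c ∈ topS S d, D.x ℓ q c) * (∑ c ∈ lowS S d, D.x ℓ q c)
      = (q⁻¹) ^ 2 • ((∑ c ∈ lowS S d, D.x ℓ q c) * (∑ c ∈ topS S d, D.x ℓ q c)) := by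
  refine sum_qcomm (D.x ℓ q) (D.x ℓ q) _ _ _ fun a ha b hb => ?_
  simp only [topS, lowS, Finset.mem_filter] at ha hb
  exact D.x_same ℓ q hq hℓ ((hS a ha.1).trans (hS b hb.1).symm) (by omega)

theorem FData.yL {K : Type} [Field K] (q : K) (hq : q ≠ 0)
    {S : Finset ℤ} {i : ZMod ℓ} (hS : ∀ c ∈ S, (c : ZMod ℓ) = i)
    (d : ℤ) :
    D.x ℓ q d * (∑ c ∈ lowS S d, D.x ℓ q c)
      = q ^ (alp ℓ i d) • ((∑ c ∈ lowS S d, D.x ℓ q c) * D.x ℓ q d) := by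
  rw [Finset.mul_sum, Finset.sum_mul, Finset.smul_sum]
  refine Finset.sum_congr rfl fun a ha => ?_
  simp only [lowS, Finset.mem_filter] at ha
  rw [D.x_comm ℓ q hq ha.2, hS a ha.1]

theorem FData.Ry {K : Type} [Field K] (q : K) (hq : q ≠ 0)
    {S : Finset ℤ} {i : ZMod ℓ} (hS : ∀ c ∈ S, (c : ZMod ℓ) = i)
    (d : ℤ) :
    (∑ c ∈ topS S d, D.x ℓ q c) * D.x ℓ q d
      = q ^ (alp ℓ i d) • (D.x ℓ q d * (∑ c ∈ topS S d, D.x ℓ q c)) := by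
  rw [Finset.mul_sum, Finset.sum_mul, Finset.smul_sum]
  refine Finset.sum_congr rfl fun a ha => ?_
  simp only [topS, Finset.mem_filter] at ha
  rw [D.x_comm ℓ q hq ha.2, hS a ha.1, alp_symm]

theorem mid_pm {S : Finset ℤ} {i : ZMod ℓ} (hS : ∀ c ∈ S, (c : ZMod ℓ) = i) {d : ℤ} (hd : (d : ZMod ℓ) ≠ i) {c : ℤ} (hc : c ∈ midS S d) :
    (d = c + 1 ∨ d = c - 1) ∧ (c : ZMod ℓ) = i := by
  simp only [midS, Finset.mem_filter] at hc
  have : c ≠ d := by rintro rfl; exact hd (hS _ hc.1)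
  exact ⟨by omega, hS _ hc.1⟩

theorem FData.serre_a {K : Type} [Field K] (q : K) (hq : q ≠ 0)
    {S : Finset ℤ} {i : ZMod ℓ} (hS : ∀ c ∈ S, (c : ZMod ℓ) = i)
    (hℓ : 3 ≤ ℓ) (d : ℤ) (hd : (d : ZMod ℓ) = i + 1 ∨ (d : ZMod ℓ) = i - 1) :
    (∑ c ∈ S, D.x ℓ q c) ^ 2 * D.x ℓ q d
      - (q + q⁻¹) • ((∑ c ∈ S, D.x ℓ q c) * D.x ℓ q d * (∑ c ∈ S, D.x ℓ q c))
      + D.x ℓ q d * (∑ c ∈ S, D.x ℓ q c) ^ 2 = 0 := by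
  have : Fact (1 < ℓ) := ⟨by omega⟩
  have h2 : 2 ≤ ℓ := by omega
  have ha := alp_adj ℓ hℓ _ _ hd
  have hdi : (d : ZMod ℓ) ≠ i := by
    intro e
    rw [e] at hd
    rcases hd with h | h
    · exact one_ne_zero (α := ZMod ℓ) (by linear_combination -h)
    · exact one_ne_zero (α := ZMod ℓ) (by linear_combination h)
  have hyL := D.yL ℓ q hq hS d
  have hRy := D.Ry ℓ q hq hS d
  rw [ha, zpow_one] at hyL hRy
  have key : ∀ a ∈ midS S d, ∀ b ∈ midS S d, a = b := by
    intro a ha b hb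
    obtain ⟨a1, a2⟩ := mid_pm ℓ hS hdi ha
    obtain ⟨b1, b2⟩ := mid_pm ℓ hS hdi hb
    rcases lt_trichotomy a b with h | h | h
    · have := cls_gap ℓ (a2.trans b2.symm) h
      omega
    · exact h
    · have := cls_gap ℓ (b2.trans a2.symm) h
      omega
  rw [split_sum S d]
  refine serre2 (A := Module.End K (Lam →₀ K)) q hq (∑ c ∈ lowS S d, D.x ℓ q c)
    (∑ c ∈ midS S d, D.x ℓ q c) (∑ c ∈ topS S d, D.x ℓ q c) (D.x ℓ q d)
    (D.NL ℓ q hq hS h2 d) (D.RN ℓ q hq hS h2 d) (D.RL ℓ q hq hS h2 d) hyL hRy ?_ ?_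
  · rw [Finset.sum_mul_sum]
    refine Finset.sum_eq_zero fun a ha => Finset.sum_eq_zero fun b hb => ?_
    rw [key a ha b hb, D.x_sq ℓ q hq]
  · rw [Finset.mul_sum, Finset.sum_mul_sum]
    refine Finset.sum_eq_zero fun a ha => Finset.sum_eq_zero fun b hb => ?_
    rw [key a ha b hb, D.x_xyx ℓ q hq (mid_pm ℓ hS hdi hb).1]

theorem FData.far {K : Type} [Field K] (q : K) (hq : q ≠ 0)
    {S : Finset ℤ} {i : ZMod ℓ} (hS : ∀ c ∈ S, (c : ZMod ℓ) = i)
    (d : ℤ) (h0 : (d : ZMod ℓ) ≠ i) (h1 : (d : ZMod ℓ) ≠ i + 1)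
    (h2 : (d : ZMod ℓ) ≠ i - 1) :
    (∑ c ∈ S, D.x ℓ q c) * D.x ℓ q d = D.x ℓ q d * (∑ c ∈ S, D.x ℓ q c) := by
  have ha := alp_far ℓ _ _ h0 h1 h2
  have hyL := D.yL ℓ q hq hS d
  have hRy := D.Ry ℓ q hq hS d
  rw [ha, zpow_zero, one_smul] at hyL hRy
  have : midS S d = ∅ := by
    rw [Finset.eq_empty_iff_forall_notMem]
    intro c hc
    obtain ⟨a, b⟩ := mid_pm ℓ hS h0 hc
    rcases a with rfl | rfl
    · apply h1; rw [← b]; push_cast; rfl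
    · apply h2; rw [← b]; push_cast; rfl
  rw [split_sum S d, this, Finset.sum_empty, add_zero, add_mul, mul_add, hyL, hRy]

theorem FData.serre_b {K : Type} [Field K] (q : K) (hq : q ≠ 0) (S : Finset ℤ) (i : ZMod 2) (hS : ∀ c ∈ S, (c : ZMod 2) = i)
    (d : ℤ) (hd : i ≠ (d : ZMod 2)) :
    (∑ c ∈ S, D.x 2 q c) ^ 3 * D.x 2 q d
      - (q ^ 2 + 1 + q ^ (-2 : ℤ)) • ((∑ c ∈ S, D.x 2 q c) ^ 2 * D.x 2 q d * (∑ c ∈ S, D.x 2 q c))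
      + (q ^ 2 + 1 + q ^ (-2 : ℤ)) • ((∑ c ∈ S, D.x 2 q c) * D.x 2 q d * (∑ c ∈ S, D.x 2 q c) ^ 2)
      - D.x 2 q d * (∑ c ∈ S, D.x 2 q c) ^ 3 = 0 := by
  have ha := alp_two _ _ hd
  have h2 := le_refl 2
  have hyL := D.yL 2 q hq hS d
  have hRy := D.Ry 2 q hq hS d
  rw [ha] at hyL hRy
  have e2 : q ^ (2 : ℤ) = q ^ 2 := by norm_cast
  rw [e2] at hyL hRy
  have comm : ∀ a ∈ midS S d, ∀ b ∈ midS S d, a ≠ b →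
      ∃ r : K, D.x 2 q a * D.x 2 q b = r • (D.x 2 q b * D.x 2 q a) := by
    intro a ha b hb hab
    obtain ⟨a1, a2⟩ := mid_pm 2 hS hd.symm ha
    obtain ⟨b1, b2⟩ := mid_pm 2 hS hd.symm hb
    exact ⟨_, D.x_comm0 2 q hq (by omega)⟩
  have three : ∀ a ∈ midS S d, ∀ b ∈ midS S d, ∀ c ∈ midS S d, a = b ∨ b = c ∨ (a ≠ b ∧ c = a) := by
    intro a ha b hb c hc
    have a1 := (mid_pm 2 hS hd.symm ha).1
    have b1 := (mid_pm 2 hS hd.symm hb).1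
    have c1 := (mid_pm 2 hS hd.symm hc).1
    omega
  have xyx : ∀ a ∈ midS S d, D.x 2 q a * (D.x 2 q d * D.x 2 q a) = 0 := fun a ha =>
    D.x_xyx 2 q hq (mid_pm 2 hS hd.symm ha).1
  have w1 : ∀ a ∈ midS S d, ∀ b ∈ midS S d, ∀ c ∈ midS S d,
      D.x 2 q a * (D.x 2 q b * D.x 2 q c) = 0 := by
    intro a ha b hb c hc
    rcases three a ha b hb c hc with rfl | rfl | ⟨h, rfl⟩
    · rw [← mul_assoc, D.x_sq 2 q hq, zero_mul]
    · rw [D.x_sq 2 q hq, mul_zero]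
    · obtain ⟨r, hr⟩ := comm b hb c hc h.symm
      rw [hr, mul_smul_comm, ← mul_assoc, D.x_sq 2 q hq, zero_mul, smul_zero]
  have w2 : ∀ a ∈ midS S d, ∀ b ∈ midS S d, ∀ c ∈ midS S d,
      D.x 2 q a * (D.x 2 q d * (D.x 2 q b * D.x 2 q c)) = 0 := by
    intro a ha b hb c hc
    rcases three a ha b hb c hc with rfl | rfl | ⟨h, rfl⟩
    · rw [← mul_assoc (D.x 2 q d), ← mul_assoc, xyx _ ha, zero_mul]
    · rw [D.x_sq 2 q hq, mul_zero, mul_zero]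
    · obtain ⟨r, hr⟩ := comm b hb c hc h.symm
      rw [hr, mul_smul_comm, mul_smul_comm, ← mul_assoc (D.x 2 q d), ← mul_assoc, xyx _ ha,
        zero_mul, smul_zero]
  have w3 : ∀ a ∈ midS S d, ∀ b ∈ midS S d, ∀ c ∈ midS S d,
      D.x 2 q a * (D.x 2 q b * (D.x 2 q d * D.x 2 q c)) = 0 := by
    intro a ha b hb c hc
    rcases three a ha b hb c hc with rfl | rfl | ⟨h, rfl⟩
    · rw [← mul_assoc, D.x_sq 2 q hq, zero_mul]
    · rw [xyx _ hb, mul_zero]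
    · obtain ⟨r, hr⟩ := comm c hc b hb h
      rw [← mul_assoc, hr, smul_mul_assoc, mul_assoc, xyx _ hc, mul_zero, smul_zero]
  rw [split_sum S d]
  refine serre3 (A := Module.End K (Lam →₀ K)) q hq (∑ c ∈ lowS S d, D.x 2 q c)
    (∑ c ∈ midS S d, D.x 2 q c) (∑ c ∈ topS S d, D.x 2 q c) (D.x 2 q d)
    (D.NL 2 q hq hS h2 d) (D.RN 2 q hq hS h2 d) (D.RL 2 q hq hS h2 d) hyL hRy ?_ ?_ ?_
  · simp only [Finset.mul_sum, Finset.sum_mul]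
    refine Finset.sum_eq_zero fun a ha => Finset.sum_eq_zero fun b hb =>
      Finset.sum_eq_zero fun c hc => ?_
    apply w1 <;> assumption
  · simp only [Finset.mul_sum, Finset.sum_mul]
    refine Finset.sum_eq_zero fun a ha => Finset.sum_eq_zero fun b hb =>
      Finset.sum_eq_zero fun c hc => ?_
    apply w2 <;> assumption
  · simp only [Finset.mul_sum, Finset.sum_mul]
    refine Finset.sum_eq_zero fun a ha => Finset.sum_eq_zero fun b hb =>
      Finset.sum_eq_zero fun c hc => ?_
    apply w3 <;> assumption

end Ser

section Loc
open Filter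
variable {K V : Type} [Field K] [AddCommGroup V] [Module K V]

/-- pointwise eventual equality of a sequence of operators -/
def Loc (A : ℕ → Module.End K V) (B : Module.End K V) : Prop :=
  ∀ v, ∀ᶠ n in atTop, A n v = B v

theorem Loc.mul {A A' : ℕ → Module.End K V} {B B' : Module.End K V} (h : Loc A B) (h' : Loc A' B') :
    Loc (fun n => A n * A' n) (B * B') := by
  intro v
  filter_upwards [h' v, h (B' v)] with n h1 h2
  simp only [Module.End.mul_apply, h1, h2]

theorem Loc.add {A A' : ℕ → Module.End K V} {B B' : Module.End K V} (h : Loc A B) (h' : Loc A' B') :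
    Loc (fun n => A n + A' n) (B + B') := by
  intro v
  filter_upwards [h' v, h v] with n h1 h2
  simp only [LinearMap.add_apply, h1, h2]

theorem Loc.sub {A A' : ℕ → Module.End K V} {B B' : Module.End K V} (h : Loc A B) (h' : Loc A' B') :
    Loc (fun n => A n - A' n) (B - B') := by
  intro v
  filter_upwards [h' v, h v] with n h1 h2
  simp only [LinearMap.sub_apply, h1, h2]

theorem Loc.smul {A : ℕ → Module.End K V} {B : Module.End K V} (r : K) (h : Loc A B) :
    Loc (fun n => r • A n) (r • B) := by
  intro v
  filter_upwards [h v] with n h2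
  simp only [LinearMap.smul_apply, h2]

theorem Loc.pow {A : ℕ → Module.End K V} {B : Module.End K V} (h : Loc A B) (k : ℕ) :
    Loc (fun n => A n ^ k) (B ^ k) := by
  induction k with
  | zero => simp only [pow_zero]; exact fun v => Eventually.of_forall fun n => rfl
  | succ k ih => simp only [pow_succ]; exact ih.mul h

theorem Loc.eq_zero {A : ℕ → Module.End K V} {B : Module.End K V} (h : Loc A B)
    (h0 : ∀ n, A n = 0) : B = 0 := by
  ext v
  obtain ⟨n, hn⟩ := (h v).exists
  rw [← hn, h0]

theorem Loc.of_basis {Lam : Type} {A : ℕ → Module.End K (Lam →₀ K)} {B : Module.End K (Lam →₀ K)}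
    (h : ∀ l, ∀ᶠ n in atTop, A n (Finsupp.single l 1) = B (Finsupp.single l 1)) : Loc A B := by
  intro v
  induction v using Finsupp.induction_linear with
  | zero => simp
  | add f g hf hg => filter_upwards [hf, hg] with n h1 h2; rw [map_add, map_add, h1, h2]
  | single l a =>
    filter_upwards [h l] with n h1
    have : Finsupp.single l a = a • Finsupp.single l (1 : K) := by simp
    rw [this, map_smul, map_smul, h1]

def cls (i : ZMod ℓ) (n : ℕ) : Finset ℤ :=
  (Finset.Icc (-(n : ℤ)) n).filter fun c => (c : ZMod ℓ) = i

theorem cls_spec (i : ZMod ℓ) (n : ℕ) : ∀ c ∈ cls ℓ i n, (c : ZMod ℓ) = i := by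
  intro c hc; simp only [cls, Finset.mem_filter] at hc; exact hc.2

theorem FData.main {Lam : Type} (D : FData Lam) (q : K) (hq : q ≠ 0)
    (X : ZMod ℓ → Module.End K (Lam →₀ K))
    (hX : ∀ i, Loc (fun n => ∑ c ∈ cls ℓ i n, D.x ℓ q c) (X i)) :
    (∀ i j : ZMod ℓ, 3 ≤ ℓ → j ≠ i → j ≠ i + 1 → j ≠ i - 1 → X i * X j = X j * X i)
    ∧ (∀ i j : ZMod ℓ, 3 ≤ ℓ → (j = i + 1 ∨ j = i - 1) →
      X i ^ 2 * X j - (q + q⁻¹) • (X i * X j * X i) + X j * X i ^ 2 = 0)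
    ∧ (∀ i j : ZMod ℓ, ℓ = 2 → i ≠ j →
      X i ^ 3 * X j - (q ^ 2 + 1 + q ^ (-2 : ℤ)) • (X i ^ 2 * X j * X i)
          + (q ^ 2 + 1 + q ^ (-2 : ℤ)) • (X i * X j * X i ^ 2) - X j * X i ^ 3 = 0) := by
  refine ⟨?_, ?_, ?_⟩
  · intro i j _ h0 h1 h2
    refine (sub_eq_zero (G := Module.End K (Lam →₀ K))).1 ?_
    refine (((hX i).mul (hX j)).sub ((hX j).mul (hX i))).eq_zero fun n => ?_
    refine comm_sum (A := Module.End K (Lam →₀ K)) (∑ c ∈ cls ℓ i n, D.x ℓ q c)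
      (D.x ℓ q) (cls ℓ j n) fun d hd => ?_
    have hd := cls_spec ℓ j n d hd
    subst hd
    exact D.far ℓ q hq (cls_spec ℓ i n) d h0 h1 h2
  · intro i j h3 hij
    refine (((((hX i).pow 2).mul (hX j)).sub ((((hX i).mul (hX j)).mul (hX i)).smul (q + q⁻¹))).add
      ((hX j).mul ((hX i).pow 2))).eq_zero fun n => ?_
    refine serre2_sum (A := Module.End K (Lam →₀ K)) (∑ c ∈ cls ℓ i n, D.x ℓ q c)
      (D.x ℓ q) (cls ℓ j n) _ fun d hd => ?_
    have hd := cls_spec ℓ j n d hd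
    subst hd
    exact D.serre_a ℓ q hq (cls_spec ℓ i n) h3 d hij
  · intro i j h3 hij
    subst h3
    refine (((((hX i).pow 3).mul (hX j)).sub
      (((((hX i).pow 2).mul (hX j)).mul (hX i)).smul _)).add
      ((((hX i).mul (hX j)).mul ((hX i).pow 2)).smul _)).sub
      ((hX j).mul ((hX i).pow 3)) |>.eq_zero fun n => ?_
    refine serre3_sum (A := Module.End K (Lam →₀ K)) (∑ c ∈ cls 2 i n, D.x 2 q c)
      (D.x 2 q) (cls 2 j n) _ fun d hd => ?_
    have hd := cls_spec 2 j n d hd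
    subst hd
    exact D.serre_b q hq (cls 2 i n) i (cls_spec 2 i n) d hij

end Loc

section Con

theorem exists_prof (μ : YoungDiagram) (e : ℤ) : ∃ t : ℤ, 0 ≤ t ∧ -e ≤ t ∧
    ∀ a b : ℕ, (b : ℤ) - a = e → ((a, b) ∈ μ ↔ (a : ℤ) < t) := by
  have hm : ∃ m : ℕ, (m : ℤ) = max 0 (-e) := ⟨(max 0 (-e)).toNat, by omega⟩
  obtain ⟨m, hm⟩ := hm
  have hk : ∃ k : ℕ, (k : ℤ) = m + e := ⟨((m : ℤ) + e).toNat, by omega⟩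
  obtain ⟨k, hk⟩ := hk
  have ex : ∃ n : ℕ, (m + n, k + n) ∉ μ := by
    by_contra hcon
    push Not at hcon
    have hinj : Function.Injective fun n : ℕ => (m + n, k + n) := by
      intro a b hab
      simp only [Prod.mk.injEq] at hab
      omega
    refine (Set.infinite_range_of_injective hinj) (Set.Finite.subset μ.cells.finite_toSet ?_)
    rintro _ ⟨n, rfl⟩
    exact hcon n
  refine ⟨m + Nat.find ex, by omega, by omega, ?_⟩
  intro a b hab
  obtain ⟨n, hn⟩ : ∃ n : ℕ, a = m + n := ⟨a - m, by omega⟩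
  have hb : b = k + n := by omega
  subst hn hb
  constructor
  · intro h
    by_contra hlt
    have hle : Nat.find ex ≤ n := by omega
    exact Nat.find_spec ex (μ.isLowerSet (a := (m + n, k + n)) ⟨by simpa using hle, by simpa using hle⟩ h)
  · intro h
    have hlt : n < Nat.find ex := by omega
    have := Nat.find_min ex hlt
    simpa using this

/-- diagonal lengths -/
def prof (μ : YoungDiagram) (e : ℤ) : ℤ := (exists_prof μ e).choose

theorem prof_nonneg (μ : YoungDiagram) (e : ℤ) : 0 ≤ prof μ e := (exists_prof μ e).choose_spec.1
theorem prof_ge (μ : YoungDiagram) (e : ℤ) : -e ≤ prof μ e := (exists_prof μ e).choose_spec.2.1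
theorem prof_mem (μ : YoungDiagram) (e : ℤ) (a b : ℕ) (h : (b : ℤ) - a = e) :
    (a, b) ∈ μ ↔ (a : ℤ) < prof μ e := (exists_prof μ e).choose_spec.2.2 a b h

theorem cell_exists {e t : ℤ} (h0 : 0 ≤ t) (h1 : -e ≤ t) : ∃ a b : ℕ, (a : ℤ) = t ∧ (b : ℤ) - a = e :=
  ⟨t.toNat, (t + e).toNat, by omega, by omega⟩

theorem prof_unique (μ : YoungDiagram) (e t : ℤ) (h0 : 0 ≤ t) (h1 : -e ≤ t)
    (h : ∀ a b : ℕ, (b : ℤ) - a = e → ((a, b) ∈ μ ↔ (a : ℤ) < t)) : prof μ e = t := by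
  rcases lt_trichotomy (prof μ e) t with hl | hl | hl
  · obtain ⟨a, b, ha, hb⟩ := cell_exists (prof_nonneg μ e) (prof_ge μ e)
    have h1 := h a b hb
    rw [prof_mem μ e a b hb] at h1
    omega
  · exact hl
  · obtain ⟨a, b, ha, hb⟩ := cell_exists h0 h1
    have h1 := h a b hb
    rw [prof_mem μ e a b hb] at h1
    omega

theorem low {μ : YoungDiagram} {a b a' b' : ℕ} (h : (a, b) ∈ μ) (ha : a' ≤ a) (hb : b' ≤ b) :
    (a', b') ∈ μ := μ.isLowerSet (a := (a, b)) ⟨ha, hb⟩ h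

theorem prof_anti1 (μ : YoungDiagram) (e : ℤ) : prof μ (e + 1) ≤ prof μ e := by
  by_contra hc
  obtain ⟨a, b, ha, hb⟩ := cell_exists (prof_nonneg μ e) (prof_ge μ e)
  have h1 : (a, b + 1) ∈ μ := (prof_mem μ (e + 1) a (b + 1) (by push_cast; omega)).2 (by omega)
  have h2 := (prof_mem μ e a b hb).1 (low h1 le_rfl (by omega))
  omega

theorem prof_step (μ : YoungDiagram) (e : ℤ) : prof μ e ≤ prof μ (e + 1) + 1 := by
  by_contra hc
  obtain ⟨a, b, ha, hb⟩ := cell_exists (prof_nonneg μ (e + 1)) (prof_ge μ (e + 1))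
  have h1 : (a + 1, b) ∈ μ := (prof_mem μ e (a + 1) b (by push_cast; omega)).2 (by push_cast; omega)
  have h2 := (prof_mem μ (e + 1) a b hb).1 (low h1 (by omega) le_rfl)
  omega

theorem prof_anti (μ : YoungDiagram) : Antitone (prof μ) :=
  antitone_int_of_succ_le (prof_anti1 μ)

theorem prof_anti1' (μ : YoungDiagram) (e : ℤ) : prof μ e ≤ prof μ (e - 1) := by
  have := prof_anti1 μ (e - 1); rwa [sub_add_cancel] at this
theorem prof_step' (μ : YoungDiagram) (e : ℤ) : prof μ (e - 1) ≤ prof μ e + 1 := by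
  have := prof_step μ (e - 1); rwa [sub_add_cancel] at this

theorem prof_inj : Function.Injective prof := by
  intro μ ν h
  apply YoungDiagram.ext
  ext ⟨a, b⟩
  have h1 := prof_mem μ _ a b rfl
  have h2 := prof_mem ν _ a b rfl
  rw [h] at h1
  exact h1.trans h2.symm

/-- removable profile -/
def Rm (g : ℤ → ℤ) (c : ℤ) : Prop := g (c - 1) = g c ∧ g (c + 1) = g c - 1

theorem addable_iff (μ : YoungDiagram) (a b : ℕ) (c : ℤ) (hc : (b : ℤ) - a = c) :
    IsAddableCell μ (a, b) ↔ prof μ c = a ∧ Ok (prof μ) c := by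
  have s1 := prof_anti1 μ c
  have s2 := prof_step μ c
  have s3 := prof_anti1' μ c
  have s4 := prof_step' μ c
  have n0 := prof_nonneg μ c
  have g0 := prof_ge μ c
  constructor
  · rintro ⟨hx, hL⟩
    have key : ∀ a' b' : ℕ, a' ≤ a → b' ≤ b → (a', b') ≠ (a, b) → (a', b') ∈ μ := by
      intro a' b' h1 h2 hne
      have := hL (a := (a, b)) (b := (a', b')) ⟨h1, h2⟩ (Or.inl rfl)
      rcases this with h | h
      · exact absurd h hne
      · exact h
    rw [prof_mem μ c a b hc] at hx
    have e1 : prof μ c = a := by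
      by_contra hne
      have hm := key (a - 1) (b - 1) (by omega) (by omega) (by simp; omega)
      rw [prof_mem μ c (a - 1) (b - 1) (by omega)] at hm
      omega
    refine ⟨e1, ?_, ?_⟩
    · by_contra hne
      have := prof_ge μ (c - 1)
      have hm := key a (b - 1) le_rfl (by omega) (by simp; omega)
      rw [prof_mem μ (c - 1) a (b - 1) (by omega)] at hm
      omega
    · by_contra hne
      have := prof_nonneg μ (c + 1)
      have hm := key (a - 1) b (by omega) le_rfl (by simp; omega)
      rw [prof_mem μ (c + 1) (a - 1) b (by omega)] at hm
      omega
  · rintro ⟨e1, o1, o2⟩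
    refine ⟨by rw [prof_mem μ c a b hc]; omega, ?_⟩
    rintro z ⟨a', b'⟩ hyz hz
    rcases hz with rfl | hz
    · have h1 : a' ≤ a := hyz.1
      have h2 : b' ≤ b := hyz.2
      by_cases hb : b' < b
      · right
        have : (a, b - 1) ∈ μ := (prof_mem μ (c - 1) a (b - 1) (by omega)).2 (by omega)
        exact low this h1 (by omega)
      · by_cases ha : a' < a
        · right
          have : (a - 1, b) ∈ μ := (prof_mem μ (c + 1) (a - 1) b (by omega)).2 (by omega)
          exact low this (by omega) h2
        · left
          simp only [Prod.mk.injEq]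
          omega
    · right
      exact μ.isLowerSet hyz hz

theorem removable_iff (μ : YoungDiagram) (a b : ℕ) (c : ℤ) (hc : (b : ℤ) - a = c) :
    IsRemovableCell μ (a, b) ↔ prof μ c = a + 1 ∧ Rm (prof μ) c := by
  have s1 := prof_anti1 μ c
  have s2 := prof_step μ c
  have s3 := prof_anti1' μ c
  have s4 := prof_step' μ c
  have m1 := prof_mem μ c a b hc
  have m2 := prof_mem μ c (a + 1) (b + 1) (by push_cast; omega)
  have m3 := prof_mem μ (c - 1) (a + 1) b (by push_cast; omega)
  have m4 := prof_mem μ (c + 1) a (b + 1) (by push_cast; omega)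
  push_cast at m1 m2 m3 m4
  constructor
  · rintro ⟨hx, hL⟩
    have key : ∀ a' b' : ℕ, a ≤ a' → b ≤ b' → (a', b') ≠ (a, b) → (a', b') ∉ μ := by
      intro a' b' h1 h2 hne hmem
      have := hL (a := (a', b')) (b := (a, b)) ⟨h1, h2⟩
        (Finset.mem_coe.2 (Finset.mem_erase.2 ⟨hne, hmem⟩))
      exact (Finset.mem_erase.1 (Finset.mem_coe.1 this)).1 rfl
    have k2 := key (a + 1) (b + 1) (by omega) (by omega) (by simp)
    have k3 := key (a + 1) b (by omega) (by omega) (by simp)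
    have k4 := key a (b + 1) (by omega) (by omega) (by simp)
    rw [m1] at hx
    rw [m2] at k2
    rw [m3] at k3
    rw [m4] at k4
    unfold Rm
    omega
  · rintro ⟨e1, o1, o2⟩
    refine ⟨m1.2 (by omega), ?_⟩
    rintro ⟨a'', b''⟩ ⟨a', b'⟩ hyz hz
    have h1 : a' ≤ a'' := hyz.1
    have h2 : b' ≤ b'' := hyz.2
    have hz : ¬ ((a'', b'') = (a, b)) ∧ (a'', b'') ∈ μ := Finset.mem_erase.1 (Finset.mem_coe.1 hz)
    have : ¬ ((a', b') = (a, b)) ∧ (a', b') ∈ μ := by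
      refine ⟨?_, low hz.2 h1 h2⟩
      intro he
      simp only [Prod.mk.injEq] at he hz
      obtain ⟨rfl, rfl⟩ := he
      by_cases h3 : a' < a''
      · have := m3.1 (low hz.2 (by omega) h2)
        omega
      · have := m4.1 (low hz.2 h1 (by omega))
        omega
    exact Finset.mem_coe.2 (Finset.mem_erase.2 this)

def acell (μ : YoungDiagram) (c : ℤ) : ℕ × ℕ := ((prof μ c).toNat, (prof μ c + c).toNat)
def rcell (μ : YoungDiagram) (c : ℤ) : ℕ × ℕ := ((prof μ c - 1).toNat, (prof μ c - 1 + c).toNat)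

theorem acell_fst (μ : YoungDiagram) (c : ℤ) : ((acell μ c).1 : ℤ) = prof μ c := by
  have := prof_nonneg μ c; simp only [acell]; omega
theorem acell_snd (μ : YoungDiagram) (c : ℤ) : ((acell μ c).2 : ℤ) = prof μ c + c := by
  have := prof_ge μ c; simp only [acell]; omega
theorem rcell_fst (μ : YoungDiagram) {c : ℤ} (h : Rm (prof μ) c) :
    ((rcell μ c).1 : ℤ) = prof μ c - 1 := by
  have := prof_nonneg μ (c + 1); have := h.2; simp only [rcell]; omega
theorem rcell_snd (μ : YoungDiagram) {c : ℤ} (h : Rm (prof μ) c) :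
    ((rcell μ c).2 : ℤ) = prof μ c - 1 + c := by
  have := prof_ge μ (c - 1); have := h.1; simp only [rcell]; omega

theorem acell_ok (μ : YoungDiagram) {c : ℤ} (h : Ok (prof μ) c) : IsAddableCell μ (acell μ c) := by
  have h1 := acell_fst μ c
  have h2 := acell_snd μ c
  exact (addable_iff μ (acell μ c).1 (acell μ c).2 c (by omega)).2 ⟨by omega, h⟩

theorem rcell_ok (μ : YoungDiagram) {c : ℤ} (h : Rm (prof μ) c) : IsRemovableCell μ (rcell μ c) := by
  have h1 := rcell_fst μ h
  have h2 := rcell_snd μ h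
  exact (removable_iff μ (rcell μ c).1 (rcell μ c).2 c (by omega)).2 ⟨by omega, h⟩

theorem prof_add (μ : YoungDiagram) (c : ℤ) (h : Ok (prof μ) c) :
    prof (addCell μ (acell μ c)) = up (prof μ) c := by
  have hx := acell_ok μ h
  have h1 := acell_fst μ c
  have h2 := acell_snd μ c
  funext e
  have n := prof_nonneg μ e
  have g := prof_ge μ e
  apply prof_unique
  · unfold up; split_ifs <;> omega
  · unfold up; split_ifs <;> omega
  intro a b hab
  have hm : (a, b) ∈ addCell μ (acell μ c) ↔ (a, b) = acell μ c ∨ (a, b) ∈ μ := by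
    unfold addCell
    rw [dif_pos hx.2, ← YoungDiagram.mem_cells]
    simp
  rw [hm, prof_mem μ e a b hab, Prod.ext_iff]
  unfold up
  simp only
  split_ifs with hec
  · subst hec; omega
  · omega

theorem prof_erase (μ : YoungDiagram) (c : ℤ) (h : Rm (prof μ) c) (e : ℤ) :
    prof (eraseCell μ (rcell μ c)) e = if e = c then prof μ e - 1 else prof μ e := by
  have hx := rcell_ok μ h
  have h1 := rcell_fst μ h
  have h2 := rcell_snd μ h
  have n := prof_nonneg μ e
  have g := prof_ge μ e
  apply prof_unique
  · split_ifs with hec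
    · subst hec; omega
    · omega
  · split_ifs with hec
    · subst hec; omega
    · omega
  intro a b hab
  have hm : (a, b) ∈ eraseCell μ (rcell μ c) ↔ (a, b) ≠ rcell μ c ∧ (a, b) ∈ μ := by
    unfold eraseCell
    rw [dif_pos hx.2, ← YoungDiagram.mem_cells]
    simp
  rw [hm, prof_mem μ e a b hab, Ne, Prod.ext_iff]
  simp only
  split_ifs with hec
  · subst hec; omega
  · omega

theorem mem_bound {μ : YoungDiagram} {a b : ℕ} (h : (a, b) ∈ μ) :
    a < μ.cells.card ∧ b < μ.cells.card := by
  constructor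
  · have : (Finset.range (a + 1)).card ≤ μ.cells.card := by
      refine Finset.card_le_card_of_injOn (fun k => (k, b)) ?_ ?_
      · intro k hk
        simp only [Finset.coe_range, Set.mem_Iio] at hk
        exact low h (by omega) le_rfl
      · intro k _ k' _ hkk
        simpa using hkk
    simpa using this
  · have : (Finset.range (b + 1)).card ≤ μ.cells.card := by
      refine Finset.card_le_card_of_injOn (fun k => (a, k)) ?_ ?_
      · intro k hk
        simp only [Finset.coe_range, Set.mem_Iio] at hk
        exact low h le_rfl (by omega)
      · intro k _ k' _ hkk
        simpa using hkk
    simpa using this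

theorem prof_big (μ : YoungDiagram) (e : ℤ) (h : (μ.cells.card : ℤ) ≤ e) : prof μ e = 0 := by
  by_contra hne
  have n := prof_nonneg μ e
  have := mem_bound ((prof_mem μ e 0 e.toNat (by omega)).2 (by omega))
  omega

theorem prof_small (μ : YoungDiagram) (e : ℤ) (h : e ≤ -(μ.cells.card : ℤ)) : prof μ e = -e := by
  by_contra hne
  have n := prof_ge μ e
  have := mem_bound ((prof_mem μ e (-e).toNat 0 (by omega)).2 (by omega))
  omega

theorem sd_zero (μ : YoungDiagram) (n : ℕ) (hn : μ.cells.card ≤ n) (e : ℤ) (h : e < -(n : ℤ) ∨ (n : ℤ) < e) :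
    sd (prof μ) e = 0 := by
  unfold sd
  rcases h with h | h
  · rw [prof_small μ e (by omega), prof_small μ (e + 1) (by omega), prof_small μ (e - 1) (by omega)]
    ring
  · rw [prof_big μ e (by omega), prof_big μ (e + 1) (by omega), prof_big μ (e - 1) (by omega)]
    ring

theorem sd_fin (μ : YoungDiagram) : {e | sd (prof μ) e ≠ 0}.Finite := by
  refine (Set.finite_Icc (-(μ.cells.card : ℤ)) μ.cells.card).subset fun e he => ?_
  by_contra hc
  refine he (sd_zero μ _ le_rfl e ?_)
  simp only [Set.mem_Icc] at hc
  omega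

theorem sd_eq (μ : YoungDiagram) (e : ℤ) :
    sd (prof μ) e = (if Ok (prof μ) e then 1 else 0) - (if Rm (prof μ) e then 1 else 0) := by
  have s1 := prof_anti1 μ e
  have s2 := prof_step μ e
  have s3 := prof_anti1' μ e
  have s4 := prof_step' μ e
  unfold sd Ok Rm
  split_ifs <;> omega

def DF : FData YoungDiagram where
  h := prof
  inj := prof_inj
  f c μ := addCell μ (acell μ c)
  hf c μ h := prof_add μ c h
  fin := sd_fin

def prof' (μ : YoungDiagram) (c : ℤ) : ℤ := - prof μ (-c)

theorem Ok_prof' (μ : YoungDiagram) (c : ℤ) : Ok (prof' μ) c ↔ Rm (prof μ) (-c) := by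
  unfold Ok Rm prof'
  rw [show -(c - 1) = -c + 1 by ring, show -(c + 1) = -c - 1 by ring]
  omega

theorem sd_prof' (μ : YoungDiagram) (c : ℤ) : sd (prof' μ) c = - sd (prof μ) (-c) := by
  unfold sd prof'
  rw [show -(c - 1) = -c + 1 by ring, show -(c + 1) = -c - 1 by ring]
  ring

def DE : FData YoungDiagram where
  h := prof'
  inj := by
    intro μ ν h
    apply prof_inj
    funext e
    have := congrFun h (-e)
    simp only [prof', neg_neg, neg_inj] at this
    exact this
  f c μ := eraseCell μ (rcell μ (-c))
  hf c μ h := by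
    rw [Ok_prof'] at h
    funext e
    unfold prof' up
    rw [prof_erase μ _ h]
    simp only [neg_inj]
    split_ifs <;> ring
  fin μ := by
    have := (sd_fin μ).preimage (f := fun e : ℤ => -e) (neg_injective.injOn)
    refine this.subset fun e he => ?_
    simp only [Set.mem_ofPred_eq, sd_prof'] at he
    simpa using he

theorem mem_addables {i : ZMod ℓ} {μ : YoungDiagram} {x : ℕ × ℕ} : x ∈ addables ℓ i μ ↔
    (x.1 < μ.cells.card + 1 ∧ x.2 < μ.cells.card + 1) ∧ IsAddableCell μ x ∧
      (((x.2 : ℤ) - (x.1 : ℤ) : ℤ) : ZMod ℓ) = i := by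
  unfold addables
  rw [Finset.mem_filter, Finset.mem_product, Finset.mem_range, Finset.mem_range]
  rfl

theorem mem_removables {i : ZMod ℓ} {μ : YoungDiagram} {x : ℕ × ℕ} : x ∈ removables ℓ i μ ↔
    x ∈ μ.cells ∧ IsRemovableCell μ x ∧ (((x.2 : ℤ) - (x.1 : ℤ) : ℤ) : ZMod ℓ) = i := by
  unfold removables
  rw [Finset.mem_filter]
  rfl

theorem sum_addables {M : Type*} [AddCommMonoid M] (i : ZMod ℓ) (μ : YoungDiagram) (n : ℕ)
    (hn : μ.cells.card ≤ n) (G : ℕ × ℕ → M) :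
    ∑ y ∈ addables ℓ i μ, G y = ∑ e ∈ cls ℓ i n, if Ok (prof μ) e then G (acell μ e) else 0 := by
  rw [← Finset.sum_filter]
  have hmem : ∀ x, IsAddableCell μ x → x.1 ≤ μ.cells.card ∧ x.2 ≤ μ.cells.card ∧
      Ok (prof μ) ((x.2 : ℤ) - x.1) ∧ acell μ ((x.2 : ℤ) - x.1) = x := by
    rintro ⟨a, b⟩ hx
    obtain ⟨e1, o⟩ := (addable_iff μ a b _ rfl).1 hx
    have h1 := prof_nonneg μ ((b : ℤ) - a)
    refine ⟨?_, ?_, o, ?_⟩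
    · by_contra hlt
      simp only at hlt
      have := prof_small μ
      have := mem_bound ((prof_mem μ ((b : ℤ) - a + 1) (a - 1) b (by omega)).2
        (by have := o.2; omega))
      omega
    · by_contra hlt
      simp only at hlt
      have := mem_bound ((prof_mem μ ((b : ℤ) - a - 1) a (b - 1) (by omega)).2
        (by have := o.1; omega))
      omega
    · simp only [acell, Prod.mk.injEq]
      omega
  refine Finset.sum_bij' (fun x _ => (x.2 : ℤ) - x.1) (fun e _ => acell μ e) ?_ ?_ ?_ ?_ ?_
  · intro x hx
    rw [mem_addables] at hx
    obtain ⟨h1, h2, h3, h4⟩ := hmem x hx.2.1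
    simp only [cls, Finset.mem_filter, Finset.mem_Icc]
    exact ⟨⟨⟨by omega, by omega⟩, hx.2.2⟩, h3⟩
  · intro e he
    simp only [cls, Finset.mem_filter] at he
    have hx := acell_ok μ he.2
    obtain ⟨h1, h2, -, -⟩ := hmem _ hx
    rw [mem_addables]
    refine ⟨⟨by omega, by omega⟩, hx, ?_⟩
    rw [acell_fst, acell_snd, add_sub_cancel_left]
    exact he.1.2
  · intro x hx
    rw [mem_addables] at hx
    exact (hmem x hx.2.1).2.2.2
  · intro e he
    rw [acell_fst, acell_snd, add_sub_cancel_left]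
  · intro x hx
    rw [mem_addables] at hx
    rw [(hmem x hx.2.1).2.2.2]

theorem sum_removables {M : Type*} [AddCommMonoid M] (i : ZMod ℓ) (μ : YoungDiagram) (n : ℕ)
    (hn : μ.cells.card ≤ n) (G : ℕ × ℕ → M) :
    ∑ y ∈ removables ℓ i μ, G y = ∑ e ∈ cls ℓ i n, if Rm (prof μ) e then G (rcell μ e) else 0 := by
  rw [← Finset.sum_filter]
  have hmem : ∀ x, IsRemovableCell μ x → x.1 ≤ μ.cells.card ∧ x.2 ≤ μ.cells.card ∧
      Rm (prof μ) ((x.2 : ℤ) - x.1) ∧ rcell μ ((x.2 : ℤ) - x.1) = x := by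
    rintro ⟨a, b⟩ hx
    obtain ⟨e1, o⟩ := (removable_iff μ a b _ rfl).1 hx
    have hb := mem_bound hx.1
    refine ⟨hb.1.le, hb.2.le, o, ?_⟩
    simp only [rcell, Prod.mk.injEq]
    omega
  refine Finset.sum_bij' (fun x _ => (x.2 : ℤ) - x.1) (fun e _ => rcell μ e) ?_ ?_ ?_ ?_ ?_
  · intro x hx
    rw [mem_removables] at hx
    obtain ⟨h1, h2, h3, h4⟩ := hmem x hx.2.1
    simp only [cls, Finset.mem_filter, Finset.mem_Icc]
    exact ⟨⟨⟨by omega, by omega⟩, hx.2.2⟩, h3⟩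
  · intro e he
    simp only [cls, Finset.mem_filter] at he
    have hx := rcell_ok μ he.2
    rw [mem_removables]
    refine ⟨hx.1, hx, ?_⟩
    rw [rcell_fst _ he.2, rcell_snd _ he.2, add_sub_cancel_left]
    exact he.1.2
  · intro x hx
    rw [mem_removables] at hx
    exact (hmem x hx.2.1).2.2.2
  · intro e he
    simp only [Finset.mem_filter] at he
    rw [rcell_fst _ he.2, rcell_snd _ he.2, add_sub_cancel_left]
  · intro x hx
    rw [mem_removables] at hx
    rw [(hmem x hx.2.1).2.2.2]

theorem kap_eq (g : ℤ → ℤ) (n : ℕ) (hg : ∀ e : ℤ, e < -(n : ℤ) ∨ (n : ℤ) < e → sd g e = 0) (c : ℤ) :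
    kap ℓ g c = ∑ e ∈ cls ℓ (c : ZMod ℓ) n, if e < c then sd g e else 0 := by
  unfold kap cls
  rw [Finset.sum_filter, finsum_eq_sum_of_support_subset (s := Finset.Icc (-(n : ℤ)) n)]
  · refine Finset.sum_congr rfl fun e _ => ?_
    unfold ind
    by_cases h1 : e < c <;> by_cases h2 : (e : ZMod ℓ) = (c : ZMod ℓ) <;> simp [h1, h2]
  · intro e he
    by_contra hc
    apply he
    simp only [Finset.coe_Icc, Set.mem_Icc] at hc
    simp only
    rw [hg e (by omega), mul_zero]

theorem card_ite (s : Finset (ℕ × ℕ)) (P : ℕ × ℕ → Prop) [DecidablePred P] :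
    ((s.filter P).card : ℤ) = ∑ y ∈ s, if P y then 1 else 0 := by
  rw [Finset.card_filter]; push_cast; rfl

theorem Nb_eq (hℓ : 2 ≤ ℓ) (μ : YoungDiagram) (c : ℤ) (hc : Ok (prof μ) c) :
    Nb ℓ (c : ZMod ℓ) μ (acell μ c) = kap ℓ (prof μ) c := by
  rw [kap_eq ℓ _ _ (sd_zero μ _ le_rfl)]
  unfold Nb
  rw [card_ite, card_ite, sum_addables ℓ _ μ _ le_rfl, sum_removables ℓ _ μ _ le_rfl,
    ← Finset.sum_sub_distrib]
  refine Finset.sum_congr rfl fun e he => ?_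
  have he := cls_spec ℓ _ _ e he
  rw [sd_eq]
  have a1 := acell_fst μ c
  have a2 := acell_fst μ e
  have o1 := hc.1
  have hA : (acell μ c).1 < (acell μ e).1 ↔ e < c := by
    constructor
    · intro h
      by_contra hlt
      have := prof_anti μ (show c ≤ e by omega)
      omega
    · intro h
      have := prof_anti μ (show e ≤ c - 1 by omega)
      omega
  have hR : Rm (prof μ) e → ((acell μ c).1 < (rcell μ e).1 ↔ e < c) := by
    intro hr
    have a3 := rcell_fst μ hr
    have o2 := hr.2
    constructor
    · intro h
      by_contra hlt
      have := prof_anti μ (show c ≤ e by omega)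
      omega
    · intro h
      have h5 := cls_gap ℓ he h
      have := prof_anti μ (show e + 1 ≤ c - 1 by omega)
      omega
  by_cases h1 : Ok (prof μ) e <;> by_cases h2 : Rm (prof μ) e
  · simp only [h1, h2, hA, hR h2, if_true]; split_ifs <;> rfl
  · simp only [h1, h2, hA, if_true, if_false, sub_zero]
  · simp only [h1, h2, hR h2, if_true, if_false]; split_ifs <;> rfl
  · simp only [h1, h2, if_false]; split_ifs <;> rfl

theorem Na_eq (hℓ : 2 ≤ ℓ) (μ : YoungDiagram) (c : ℤ) (hc : Ok (prof μ) c) (n : ℕ)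
    (hn : μ.cells.card ≤ n) :
    Na ℓ (c : ZMod ℓ) μ (acell μ c) =
      ∑ e ∈ cls ℓ (c : ZMod ℓ) n, if c < e then sd (prof μ) e else 0 := by
  unfold Na
  rw [card_ite, card_ite, sum_addables ℓ _ μ _ hn, sum_removables ℓ _ μ _ hn,
    ← Finset.sum_sub_distrib]
  refine Finset.sum_congr rfl fun e he => ?_
  have he := cls_spec ℓ _ _ e he
  rw [sd_eq]
  have a1 := acell_fst μ c
  have a2 := acell_fst μ e
  have o1 := hc.1
  have hA : Ok (prof μ) e → ((acell μ e).1 < (acell μ c).1 ↔ c < e) := by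
    intro hr
    have o2 := hr.1
    constructor
    · intro h
      by_contra hlt
      have := prof_anti μ (show e ≤ c by omega)
      omega
    · intro h
      have := prof_anti μ (show c ≤ e - 1 by omega)
      omega
  have hR : Rm (prof μ) e → ((rcell μ e).1 < (acell μ c).1 ↔ c < e) := by
    intro hr
    have a3 := rcell_fst μ hr
    constructor
    · intro h
      by_contra hlt
      rcases eq_or_lt_of_le (not_lt.1 hlt) with h5 | h5
      · subst h5
        have := hr.1
        omega
      · have := prof_anti μ (show e ≤ c - 1 by omega)
        omega
    · intro h
      have := prof_anti μ (show c ≤ e by omega)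
      omega
  by_cases h1 : Ok (prof μ) e <;> by_cases h2 : Rm (prof μ) e
  · simp only [h1, h2, hA h1, hR h2, if_true]; split_ifs <;> rfl
  · simp only [h1, h2, hA h1, if_true, if_false, sub_zero]
  · simp only [h1, h2, hR h2, if_true, if_false]; split_ifs <;> rfl
  · simp only [h1, h2, if_false]; split_ifs <;> rfl

theorem Na_erase (hℓ : 2 ≤ ℓ) (μ : YoungDiagram) (c : ℤ) (hc : Rm (prof μ) c) :
    -(Na ℓ (c : ZMod ℓ) (eraseCell μ (rcell μ c)) (rcell μ c)) = kap ℓ (prof' μ) (-c) := by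
  obtain ⟨n, hn, hn'⟩ : ∃ n : ℕ, μ.cells.card ≤ n ∧ (eraseCell μ (rcell μ c)).cells.card ≤ n :=
    ⟨max _ _, le_max_left _ _, le_max_right _ _⟩
  have hp := prof_erase μ c hc
  have hok : Ok (prof (eraseCell μ (rcell μ c))) c := by
    have := hc.1
    have := hc.2
    unfold Ok
    rw [hp, hp, hp, if_neg (by omega), if_pos rfl, if_neg (by omega)]
    omega
  have hce : acell (eraseCell μ (rcell μ c)) c = rcell μ c := by
    unfold acell
    rw [hp, if_pos rfl]
    rfl
  have h := Na_eq ℓ hℓ _ c hok n hn'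
  rw [hce] at h
  rw [h, kap_eq ℓ (prof' μ) n]
  · rw [← Finset.sum_neg_distrib]
    refine Finset.sum_bij' (fun e _ => -e) (fun e _ => -e) ?_ ?_ ?_ ?_ ?_
    · intro e he
      simp only [cls, Finset.mem_filter, Finset.mem_Icc] at he ⊢
      refine ⟨by omega, ?_⟩
      rw [Int.cast_neg, Int.cast_neg, he.2]
    · intro e he
      simp only [cls, Finset.mem_filter, Finset.mem_Icc] at he ⊢
      refine ⟨by omega, ?_⟩
      rw [Int.cast_neg, he.2, Int.cast_neg, neg_neg]
    · intro e _; exact neg_neg e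
    · intro e _; exact neg_neg e
    · intro e he
      have he := cls_spec ℓ _ _ e he
      rw [sd_prof', neg_neg]
      by_cases hlt : c < e
      · have h5 := cls_gap ℓ he.symm hlt
        rw [if_pos hlt, if_pos (by omega)]
        unfold sd
        rw [hp, hp, hp, if_neg (by omega), if_neg (by omega), if_neg (by omega)]
      · rw [if_neg hlt, if_neg (by omega), neg_zero]
  · intro e he
    rw [sd_prof', sd_zero μ n hn _ (by omega), neg_zero]

theorem Fop_single (i : ZMod ℓ) (μ : YoungDiagram) : Fop ℓ i (Finsupp.single μ 1) =
    ∑ x ∈ addables ℓ i μ, (qq ^ (Nb ℓ i μ x)) • Finsupp.single (addCell μ x) (1 : Fq) := by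
  rw [Fop, Finsupp.linearCombination_single, one_smul]

theorem Eop_single (i : ZMod ℓ) (μ : YoungDiagram) : Eop ℓ i (Finsupp.single μ 1) =
    ∑ x ∈ removables ℓ i μ,
      (qq ^ (-(Na ℓ i (eraseCell μ x) x))) • Finsupp.single (eraseCell μ x) (1 : Fq) := by
  rw [Eop, Finsupp.linearCombination_single, one_smul]

theorem loc_F (hℓ : 2 ≤ ℓ) (i : ZMod ℓ) :
    Loc (fun n => ∑ c ∈ cls ℓ i n, DF.x ℓ qq c) (Fop ℓ i) := by
  apply Loc.of_basis
  intro μ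
  filter_upwards [Filter.eventually_ge_atTop μ.cells.card] with n hn
  rw [Fop_single, sum_addables ℓ i μ n hn, LinearMap.sum_apply]
  refine Finset.sum_congr rfl fun c hc => ?_
  have hc := cls_spec ℓ _ _ c hc
  subst hc
  rw [FData.x_single]
  change (if Ok (prof μ) c then _ else _) = _
  by_cases ho : Ok (prof μ) c
  · rw [if_pos ho, if_pos ho, Nb_eq ℓ hℓ μ c ho]; rfl
  · rw [if_neg ho, if_neg ho]

theorem loc_E (hℓ : 2 ≤ ℓ) (i : ZMod ℓ) :
    Loc (fun n => ∑ c ∈ cls ℓ i n, DE.x ℓ qq c) (Eop ℓ (-i)) := by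
  apply Loc.of_basis
  intro μ
  filter_upwards [Filter.eventually_ge_atTop μ.cells.card] with n hn
  rw [Eop_single, sum_removables ℓ (-i) μ n hn, LinearMap.sum_apply]
  refine Finset.sum_bij' (fun e _ => -e) (fun e _ => -e) ?_ ?_ ?_ ?_ ?_
  · intro e he
    simp only [cls, Finset.mem_filter, Finset.mem_Icc] at he ⊢
    refine ⟨by omega, ?_⟩
    rw [Int.cast_neg, he.2]
  · intro e he
    simp only [cls, Finset.mem_filter, Finset.mem_Icc] at he ⊢
    refine ⟨by omega, ?_⟩
    rw [Int.cast_neg, he.2, neg_neg]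
  · intro e _; exact neg_neg e
  · intro e _; exact neg_neg e
  · intro c hc
    have hc := cls_spec ℓ _ _ c hc
    subst hc
    rw [FData.x_single]
    change (if Ok (prof' μ) c then _ else _) = _
    by_cases ho : Ok (prof' μ) c
    · have hr := (Ok_prof' μ c).1 ho
      have hN := Na_erase ℓ hℓ μ (-c) hr
      rw [Int.cast_neg, neg_neg] at hN
      rw [if_pos ho, if_pos hr, hN]; rfl
    · rw [if_neg ho, if_neg (fun hr => ho ((Ok_prof' μ c).2 hr))]

end Con

/-- Hayashi realization of the Fock space: `q`-Serre relations.
For `ℓ ≥ 3`: `E_i E_j = E_j E_i` and `F_i F_j = F_j F_i` when `j ≢ i, i ± 1 (mod ℓ)`, and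
`E_i² E_j - (q+q⁻¹) E_i E_j E_i + E_j E_i² = 0` (and likewise for `F`) when
`j ≡ i ± 1 (mod ℓ)`.  For `ℓ = 2` and `i ≠ j`:
`E_i³ E_j - [3] E_i² E_j E_i + [3] E_i E_j E_i² - E_j E_i³ = 0` (and likewise for `F`),
where `[3] = q² + 1 + q⁻²`. -/
theorem statement10 (hℓ : 2 ≤ ℓ) :
    (∀ i j : ZMod ℓ, 3 ≤ ℓ → j ≠ i → j ≠ i + 1 → j ≠ i - 1 →
      Eop ℓ i * Eop ℓ j = Eop ℓ j * Eop ℓ i ∧ Fop ℓ i * Fop ℓ j = Fop ℓ j * Fop ℓ i)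
    ∧ (∀ i j : ZMod ℓ, 3 ≤ ℓ → (j = i + 1 ∨ j = i - 1) →
      (Eop ℓ i ^ 2 * Eop ℓ j - (qq + qq⁻¹) • (Eop ℓ i * Eop ℓ j * Eop ℓ i)
          + Eop ℓ j * Eop ℓ i ^ 2 = 0)
      ∧ (Fop ℓ i ^ 2 * Fop ℓ j - (qq + qq⁻¹) • (Fop ℓ i * Fop ℓ j * Fop ℓ i)
          + Fop ℓ j * Fop ℓ i ^ 2 = 0))
    ∧ (∀ i j : ZMod ℓ, ℓ = 2 → i ≠ j →
      (Eop ℓ i ^ 3 * Eop ℓ j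
          - (qq ^ 2 + 1 + qq ^ (-2 : ℤ)) • (Eop ℓ i ^ 2 * Eop ℓ j * Eop ℓ i)
          + (qq ^ 2 + 1 + qq ^ (-2 : ℤ)) • (Eop ℓ i * Eop ℓ j * Eop ℓ i ^ 2)
          - Eop ℓ j * Eop ℓ i ^ 3 = 0)
      ∧ (Fop ℓ i ^ 3 * Fop ℓ j
          - (qq ^ 2 + 1 + qq ^ (-2 : ℤ)) • (Fop ℓ i ^ 2 * Fop ℓ j * Fop ℓ i)
          + (qq ^ 2 + 1 + qq ^ (-2 : ℤ)) • (Fop ℓ i * Fop ℓ j * Fop ℓ i ^ 2)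
          - Fop ℓ j * Fop ℓ i ^ 3 = 0)) := by
  have hq : qq ≠ 0 := RatFunc.X_ne_zero
  obtain ⟨f1, f2, f3⟩ := FData.main ℓ DF qq hq (Fop ℓ) (loc_F ℓ hℓ)
  obtain ⟨e1, e2, e3⟩ := FData.main ℓ DE qq hq (fun i => Eop ℓ (-i)) (loc_E ℓ hℓ)
  refine ⟨?_, ?_, ?_⟩
  · intro i j h3 h0 h1 h2
    refine ⟨?_, f1 i j h3 h0 h1 h2⟩
    have := e1 (-i) (-j) h3 (fun h => h0 (neg_injective h))
      (fun h => h2 (by rw [← neg_neg j, h]; ring)) (fun h => h1 (by rw [← neg_neg j, h]; ring))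
    simp only [neg_neg] at this
    exact this
  · intro i j h3 hij
    refine ⟨?_, f2 i j h3 hij⟩
    have := e2 (-i) (-j) h3 (by
      rcases hij with h | h
      · right; rw [h]; ring
      · left; rw [h]; ring)
    simp only [neg_neg] at this
    exact this
  · intro i j h2 hij
    refine ⟨?_, f3 i j h2 hij⟩
    have := e3 (-i) (-j) h2 (fun h => hij (neg_injective h))
    simp only [neg_neg] at this
    exact this

end FockSpace
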